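/- Define Φ(ρ) = (X₁(ρ), X₂(ρ), X₃(ρ)) for triples ρ of positive reals. Let n ≥ 1 be an integer and let ρ = (ρ₁,ρ₂,ρ₃) have all entries positive. Suppose that for each j = 1, …, n the j-fold iterate Φ^j(ρ) is defined and has all entries positive, and that Φ^n(ρ) = ρ. Then ρ₁ = ρ₂ = ρ₃; moreover, if n is odd then ρ₁ = ρ₂ = ρ₃ = 1/4. -/

import Mathlib

/-- The diagonal entry of the cross curvature (0,2)-tensor of the left-invariant
metric on `SU(2)` with diagonal entries `(a,b,c)` in a Milnor frame, in the direction
of the first entry; it is symmetric in `b` and `c`. -/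
noncomputable def crossX (a b c : ℝ) : ℝ :=
  ((a ^ 2 + b ^ 2 - 3 * c ^ 2 - 2 * a * b + 2 * a * c + 2 * b * c) *
    (a ^ 2 - 3 * b ^ 2 + c ^ 2 + 2 * a * b - 2 * a * c + 2 * b * c)) /
    (16 * a * b ^ 2 * c ^ 2)

/-- The cross curvature map `Φ(ρ) = (X₁(ρ), X₂(ρ), X₃(ρ))` on diagonal left-invariant
metrics on `SU(2)` written in a Milnor frame. -/
noncomputable def PhiX (ρ : ℝ × ℝ × ℝ) : ℝ × ℝ × ℝ :=
  (crossX ρ.1 ρ.2.1 ρ.2.2, crossX ρ.2.1 ρ.1 ρ.2.2, crossX ρ.2.2 ρ.1 ρ.2.1)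


lemma crossX_symm (a b c : ℝ) : crossX a b c = crossX a c b := by
  unfold crossX
  congr 1 <;> ring

lemma crossX_ratio {a b c : ℝ} (ha : 0 < a) (hb : 0 < b) (hc : 0 < c) (hab : b < a)
    (hA : 0 < crossX a b c) (hB : 0 < crossX b a c) (hC : 0 < crossX c a b) :
    a * crossX b a c < crossX a b c * b := by
  obtain ⟨p, hp⟩ : ∃ p, p = (b - c) ^ 2 + 2 * a * (b + c) - 3 * a ^ 2 := ⟨_, rfl⟩
  obtain ⟨q, hq⟩ : ∃ q, q = (a - c) ^ 2 + 2 * b * (a + c) - 3 * b ^ 2 := ⟨_, rfl⟩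
  obtain ⟨r, hr⟩ : ∃ r, r = (a - b) ^ 2 + 2 * c * (a + b) - 3 * c ^ 2 := ⟨_, rfl⟩
  have eA : crossX a b c = q * r / (16 * a * b ^ 2 * c ^ 2) := by
    unfold crossX; rw [hq, hr]; congr 1; ring
  have eB : crossX b a c = p * r / (16 * b * a ^ 2 * c ^ 2) := by
    unfold crossX; rw [hp, hr]; congr 1; ring
  have eC : crossX c a b = p * q / (16 * c * a ^ 2 * b ^ 2) := by
    unfold crossX; rw [hp, hq]; congr 1; ring
  have hqr : 0 < q * r := by
    rw [eA] at hA; exact (div_pos_iff_of_pos_right (by positivity)).1 hA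
  have hpr : 0 < p * r := by
    rw [eB] at hB; exact (div_pos_iff_of_pos_right (by positivity)).1 hB
  have hpq : 0 < p * q := by
    rw [eC] at hC; exact (div_pos_iff_of_pos_right (by positivity)).1 hC
  have s1 : p + r = 2 * (b - (a - c)) * (b + (a - c)) := by rw [hp, hr]; ring
  have s2 : q + r = 2 * (a - (b - c)) * (a + (b - c)) := by rw [hq, hr]; ring
  have s3 : p + q = 2 * (c - (a - b)) * (c + (a - b)) := by rw [hp, hq]; ring
  have s4 : q - p = 4 * (a - b) * (a + b - c) := by rw [hp, hq]; ring
  have hr0 : 0 < r := by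
    by_contra h
    have hr' : r < 0 := lt_of_le_of_ne (not_lt.1 h) (by rintro rfl; simp at hqr)
    have hp' : p < 0 := by nlinarith
    have hq' : q < 0 := by nlinarith
    have t3 : c < a - b := by
      by_contra h3
      nlinarith [mul_nonneg (by linarith : 0 ≤ c - (a - b)) (by linarith : 0 ≤ c + (a - b))]
    nlinarith [mul_pos (by linarith : 0 < a - (b - c)) (by linarith : 0 < a + (b - c))]
  have hp0 : 0 < p := (pos_iff_pos_of_mul_pos hpr).2 hr0
  have hq0 : 0 < q := (pos_iff_pos_of_mul_pos hqr).2 hr0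
  have tc : c < a + b := by
    by_contra h
    nlinarith [mul_nonneg (by linarith : 0 ≤ c - a - b) (by linarith : 0 ≤ b + c - a)]
  have hpq' : p < q := by
    nlinarith [mul_pos (sub_pos.2 hab) (by linarith : 0 < a + b - c)]
  have e1 : a * crossX b a c = p * r / (16 * a * b * c ^ 2) := by
    rw [eB]; field_simp
  have e2 : crossX a b c * b = q * r / (16 * a * b * c ^ 2) := by
    rw [eA]; field_simp
  rw [e1, e2]
  gcongr

lemma no_gap (n : ℕ) (hn : 1 ≤ n) (u v w : ℕ → ℝ)
    (hpos : ∀ j ≤ n, 0 < u j ∧ 0 < v j ∧ 0 < w j)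
    (hu : ∀ j, u (j + 1) = crossX (u j) (v j) (w j))
    (hv : ∀ j, v (j + 1) = crossX (v j) (u j) (w j))
    (hw : ∀ j, w (j + 1) = crossX (w j) (u j) (v j))
    (hun : u n = u 0) (hvn : v n = v 0) : u 0 ≤ v 0 := by
  by_contra h
  push Not at h
  have key : ∀ j, j + 1 ≤ n → v j < u j → u j / v j < u (j + 1) / v (j + 1) := by
    intro j hj hlt
    obtain ⟨a, b, c⟩ := hpos j (by omega)
    obtain ⟨a', b', c'⟩ := hpos (j + 1) hj
    rw [div_lt_div_iff₀ b b', hu, hv]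
    rw [hu] at a'; rw [hv] at b'; rw [hw] at c'
    exact crossX_ratio a b c hlt a' b' c'
  have main : ∀ j, j + 1 ≤ n → u 0 / v 0 < u (j + 1) / v (j + 1) := by
    intro j
    induction j with
    | zero => exact fun hj => key 0 hj h
    | succ k ih =>
      intro hj
      have h1 := ih (by omega)
      refine h1.trans (key (k + 1) hj ?_)
      have h0 := (one_lt_div (hpos 0 (by omega)).2.1).2 h
      exact (one_lt_div (hpos (k + 1) (by omega)).2.1).1 (h0.trans h1)
  obtain ⟨m, rfl⟩ : ∃ m, n = m + 1 := ⟨n - 1, by omega⟩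
  have := main m le_rfl
  rw [hun, hvn] at this
  exact lt_irrefl _ this

lemma PhiX_diag {t : ℝ} (ht : 0 < t) : PhiX (t, t, t) = (1 / (16 * t), 1 / (16 * t), 1 / (16 * t)) := by
  have : crossX t t t = 1 / (16 * t) := by
    unfold crossX; field_simp; ring
  simp only [PhiX, this]

lemma PhiX_diag_two {t : ℝ} (ht : 0 < t) : PhiX^[2] (t, t, t) = (t, t, t) := by
  have h : 1 / (16 * (1 / (16 * t))) = t := by field_simp
  simp only [Function.iterate_succ, Function.iterate_zero, Function.comp, id]
  rw [PhiX_diag ht, PhiX_diag (by positivity), h]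

/-- periodic orbits of `g ↦ X(g)` on left-invariant metrics on
`SU(2)`, diagonal version: if `ρ` has positive entries, all iterates `Φ^j(ρ)` for
`1 ≤ j ≤ n` have positive entries, and `Φ^n(ρ) = ρ`, then `ρ₁ = ρ₂ = ρ₃`; moreover
if `n` is odd then `ρ₁ = ρ₂ = ρ₃ = 1/4`. -/
theorem stmt_19 (n : ℕ) (hn : 1 ≤ n) (ρ : ℝ × ℝ × ℝ)
    (hρ : 0 < ρ.1 ∧ 0 < ρ.2.1 ∧ 0 < ρ.2.2)
    (hpos : ∀ j : ℕ, 1 ≤ j → j ≤ n →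
      0 < (PhiX^[j] ρ).1 ∧ 0 < (PhiX^[j] ρ).2.1 ∧ 0 < (PhiX^[j] ρ).2.2)
    (hper : PhiX^[n] ρ = ρ) :
    (ρ.1 = ρ.2.1 ∧ ρ.2.1 = ρ.2.2) ∧ (Odd n → ρ.1 = 1 / 4) := by
  have hp : ∀ j ≤ n, 0 < (PhiX^[j] ρ).1 ∧ 0 < (PhiX^[j] ρ).2.1 ∧ 0 < (PhiX^[j] ρ).2.2 := by
    intro j hj
    rcases Nat.eq_zero_or_pos j with rfl | h
    · exact hρ
    · exact hpos j h hj
  obtain ⟨u, hu⟩ : ∃ u : ℕ → ℝ, ∀ j, u j = (PhiX^[j] ρ).1 := ⟨_, fun _ => rfl⟩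
  obtain ⟨v, hv⟩ : ∃ v : ℕ → ℝ, ∀ j, v j = (PhiX^[j] ρ).2.1 := ⟨_, fun _ => rfl⟩
  obtain ⟨w, hw⟩ : ∃ w : ℕ → ℝ, ∀ j, w j = (PhiX^[j] ρ).2.2 := ⟨_, fun _ => rfl⟩
  simp only [← hu, ← hv, ← hw] at hp
  have su : ∀ j, u (j + 1) = crossX (u j) (v j) (w j) := by
    intro j; rw [hu, hu, hv, hw, Function.iterate_succ_apply']; rfl
  have sv : ∀ j, v (j + 1) = crossX (v j) (u j) (w j) := by
    intro j; rw [hv, hu, hv, hw, Function.iterate_succ_apply']; rfl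
  have sw : ∀ j, w (j + 1) = crossX (w j) (u j) (v j) := by
    intro j; rw [hw, hu, hv, hw, Function.iterate_succ_apply']; rfl
  have su' : ∀ j, u (j + 1) = crossX (u j) (w j) (v j) := fun j => (su j).trans (crossX_symm _ _ _)
  have sv' : ∀ j, v (j + 1) = crossX (v j) (w j) (u j) := fun j => (sv j).trans (crossX_symm _ _ _)
  have sw' : ∀ j, w (j + 1) = crossX (w j) (v j) (u j) := fun j => (sw j).trans (crossX_symm _ _ _)
  have un : u n = u 0 := by rw [hu, hu, hper]; rfl
  have vn : v n = v 0 := by rw [hv, hv, hper]; rfl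
  have wn : w n = w 0 := by rw [hw, hw, hper]; rfl
  have h12 : u 0 = v 0 := le_antisymm
    (no_gap n hn u v w hp su sv sw un vn)
    (no_gap n hn v u w (fun j hj => ⟨(hp j hj).2.1, (hp j hj).1, (hp j hj).2.2⟩) sv su sw' vn un)
  have h23 : v 0 = w 0 := le_antisymm
    (no_gap n hn v w u (fun j hj => ⟨(hp j hj).2.1, (hp j hj).2.2, (hp j hj).1⟩) sv' sw' su vn wn)
    (no_gap n hn w v u (fun j hj => ⟨(hp j hj).2.2, (hp j hj).2.1, (hp j hj).1⟩) sw' sv' su' wn vn)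
  rw [hu, hv] at h12
  rw [hv, hw] at h23
  simp only [Function.iterate_zero, id] at h12 h23
  refine ⟨⟨h12, h23⟩, ?_⟩
  rintro ⟨m, rfl⟩
  obtain ⟨t, b, c⟩ := ρ
  simp only at h12 h23 hρ ⊢
  subst h12
  subst h23
  have ht := hρ.1
  rw [← Nat.succ_eq_add_one, Function.iterate_succ_apply', Function.iterate_mul,
    Function.iterate_fixed (PhiX_diag_two ht), PhiX_diag ht] at hper
  have h := congrArg Prod.fst hper
  simp only at h
  rw [div_eq_iff (by positivity)] at h
  nlinarith
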